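/- arXiv:math/0208166 — 4 statements merged into one kernel-verified Lean document; each statement's English description precedes it below -/
import Mathlib

section
/- Let s ≥ 1 with 2s ≤ n − 1. Then the intersection Q_{n−1}(span{e_0, e_1}) ∩ Q_{n−1}(span{e_2, e_3}) ∩ … ∩ Q_{n−1}(span{e_{2s−2}, e_{2s−1}}) inside ⋀^{n−1} V equals the span of the basis monomials of degree n−1 that are divisible by e_0 ∧ e_1 ∧ … ∧ e_{2s−1}, i.e., the span of the elements e_0 ∧ e_1 ∧ … ∧ e_{2s−1} ∧ e_{α_1} ∧ … ∧ e_{α_t} where t = n − 1 − 2s and 2s ≤ α_1 < … < α_t ≤ n. -/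
open ExteriorAlgebra
open scoped Fin.NatCast

/-- `Q K d H` : the `K`-linear span in `⋀^d V` of all elements `x ∧ y ∧ m` with
`x, y ∈ H` and `m ∈ ⋀^(d-2) V`. -/
def Q (K : Type*) {V : Type*} [Field K] [AddCommGroup V] [Module K V]
    (d : ℕ) (H : Submodule K V) : Submodule K (ExteriorAlgebra K V) :=
  Submodule.span K
    {z | ∃ x ∈ H, ∃ y ∈ H, ∃ m ∈ ⋀[K]^(d-2) V, z = ι K x * ι K y * m}

/-- The basis monomial `e_{j₁} ∧ ⋯ ∧ e_{j_d}` of the exterior algebra associated to a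
finite set `T = {j₁ < ⋯ < j_d}` of indices (the product taken in increasing order). -/
noncomputable def expMonomial {K V : Type*} [Field K] [AddCommGroup V] [Module K V]
    {n : ℕ} (e : Module.Basis (Fin (n + 1)) K V) (T : Finset (Fin (n + 1))) :
    ExteriorAlgebra K V :=
  ((T.sort (· ≤ ·)).map fun i => ι K (e i)).prod


open Module in
lemma expMonomial_eq_basis {K V : Type*} [Field K] [AddCommGroup V] [Module K V]
    {n : ℕ} (e : Module.Basis (Fin (n + 1)) K V) (T : Finset (Fin (n + 1))) :
    expMonomial e T = e.ExteriorAlgebra T := by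
  rw [basis_apply_ofCard e (rfl : T.card = T.card), expMonomial, ιMulti_family, ιMulti_apply,
    ← Finset.listMap_orderEmbOfFin_finRange T rfl, List.ofFn_eq_map, List.map_map]
  rfl

lemma basis_singleton_aux {K V : Type*} [Field K] [AddCommGroup V] [Module K V]
    {n : ℕ} (e : Module.Basis (Fin (n + 1)) K V) (i : Fin (n + 1)) :
    e.ExteriorAlgebra {i} = ι K (e i) := by
  rw [← expMonomial_eq_basis]
  simp [expMonomial]

lemma mul_of_mem_aux {K V : Type*} [Field K] [AddCommGroup V] [Module K V]
    {n : ℕ} (e : Module.Basis (Fin (n + 1)) K V) (i : Fin (n + 1)) (T : Finset (Fin (n + 1)))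
    (h : i ∈ T) : ι K (e i) * e.ExteriorAlgebra T = 0 := by
  rw [← basis_singleton_aux]
  exact basis_mul_of_not_disjoint e (Set.powersetCard.ofCard (Finset.card_singleton i))
    (Set.powersetCard.ofCard (rfl : T.card = T.card)) (by simpa [Set.powersetCard.ofCard] using h)

lemma mul_of_notMem_aux {K V : Type*} [Field K] [AddCommGroup V] [Module K V]
    {n : ℕ} (e : Module.Basis (Fin (n + 1)) K V) (i : Fin (n + 1)) (T : Finset (Fin (n + 1)))
    (h : i ∉ T) : ∃ u : K, u ≠ 0 ∧
      ι K (e i) * e.ExteriorAlgebra T = u • e.ExteriorAlgebra (insert i T) := by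
  have hd : Disjoint (Set.powersetCard.ofCard (Finset.card_singleton i)).val
      (Set.powersetCard.ofCard (rfl : T.card = T.card)).val := by
    simpa [Set.powersetCard.ofCard] using h
  have := basis_mul_of_disjoint e (Set.powersetCard.ofCard (Finset.card_singleton i))
    (Set.powersetCard.ofCard (rfl : T.card = T.card)) hd
  have h2 : ((Set.powersetCard.disjUnion hd : Set.powersetCard _ _) : Finset (Fin (n+1)))
      = insert i T := by
    ext x; simp [Set.powersetCard.disjUnion, Set.powersetCard.ofCard]
  rw [h2] at this
  rw [← basis_singleton_aux]
  refine ⟨((((Set.powersetCard.permOfDisjoint hd).sign : ℤˣ) : ℤ) : K), ?_, ?_⟩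
  · rcases Int.units_eq_one_or (Set.powersetCard.permOfDisjoint hd).sign with h | h <;> simp [h]
  · refine this.trans ?_
    rw [Units.smul_def, Int.cast_smul_eq_zsmul]

lemma basis_mem_aux {K V : Type*} [Field K] [AddCommGroup V] [Module K V]
    {n : ℕ} (e : Module.Basis (Fin (n + 1)) K V) (T : Finset (Fin (n + 1))) {k : ℕ}
    (h : T.card = k) : e.ExteriorAlgebra T ∈ ⋀[K]^k V := by
  rw [basis_apply_ofCard e h]
  exact ιMulti_range K k ⟨_, rfl⟩

lemma Q_eq_aux {K V : Type*} [Field K] [AddCommGroup V] [Module K V]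
    {n : ℕ} (e : Module.Basis (Fin (n + 1)) K V) (d : ℕ) (hd : 2 ≤ d) (a c : Fin (n + 1))
    (hac : a ≠ c) :
    Q K d (Submodule.span K {e a, e c}) =
      Submodule.span K (e.ExteriorAlgebra '' {T | T.card = d ∧ a ∈ T ∧ c ∈ T}) := by
  apply le_antisymm
  · refine Submodule.span_le.2 ?_
    rintro z ⟨x, hx, y, hy, m, hm, rfl⟩
    obtain ⟨p, q, rfl⟩ := Submodule.mem_span_pair.1 hx
    obtain ⟨r, t, rfl⟩ := Submodule.mem_span_pair.1 hy
    have hca : ι K (e c) * ι K (e a) = - (ι K (e a) * ι K (e c)) :=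
      eq_neg_of_add_eq_zero_left (ι_add_mul_swap _ _)
    have hxy : ι K (p • e a + q • e c) * ι K (r • e a + t • e c)
        = (p * t - q * r) • (ι K (e a) * ι K (e c)) := by
      simp only [map_add, map_smul, add_mul, mul_add, smul_mul_assoc, mul_smul_comm, ι_sq_zero,
        hca]
      module
    rw [hxy, smul_mul_assoc]
    refine Submodule.smul_mem _ _ ?_
    rw [← exteriorPower.ιMulti_family_span_fixedDegree_of_span K e.span_eq] at hm
    induction hm using Submodule.span_induction with
    | zero => simp
    | add u v _ _ hu hv => rw [mul_add]; exact Submodule.add_mem _ hu hv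
    | smul k u _ hu => rw [mul_smul_comm]; exact Submodule.smul_mem _ _ hu
    | mem u hu =>
      obtain ⟨T, rfl⟩ := hu
      rw [← basis_apply_powersetCard, mul_assoc]
      have hT : (T : Finset (Fin (n+1))).card = d - 2 := T.2
      generalize (T : Finset (Fin (n+1))) = T' at hT
      by_cases h1 : c ∈ T'
      · simp [mul_of_mem_aux e c T' h1]
      obtain ⟨u, -, hu⟩ := mul_of_notMem_aux e c T' h1
      rw [hu, mul_smul_comm]
      refine Submodule.smul_mem _ _ ?_
      by_cases h2 : a ∈ insert c T'
      · simp [mul_of_mem_aux e a _ h2]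
      obtain ⟨v, -, hv⟩ := mul_of_notMem_aux e a _ h2
      rw [hv]
      refine Submodule.smul_mem _ _ (Submodule.subset_span ⟨_, ⟨?_, ?_, ?_⟩, rfl⟩)
      · rw [Finset.card_insert_of_notMem h2, Finset.card_insert_of_notMem h1]; omega
      · simp
      · simp
  · refine Submodule.span_le.2 ?_
    rintro _ ⟨T, ⟨hT, ha, hc⟩, rfl⟩
    have hc' : c ∈ T.erase a := Finset.mem_erase.2 ⟨hac.symm, hc⟩
    obtain ⟨u, hu0, hu⟩ := mul_of_notMem_aux e c ((T.erase a).erase c) (by simp)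
    obtain ⟨v, hv0, hv⟩ := mul_of_notMem_aux e a (T.erase a) (by simp)
    rw [Finset.insert_erase hc'] at hu
    rw [Finset.insert_erase ha] at hv
    have key : e.ExteriorAlgebra T = (v⁻¹ * u⁻¹) •
        (ι K (e a) * ι K (e c) * e.ExteriorAlgebra ((T.erase a).erase c)) := by
      rw [mul_assoc, hu, mul_smul_comm, hv, smul_smul, smul_smul]
      field_simp
      simp
    rw [SetLike.mem_coe, key]
    refine Submodule.smul_mem _ _ (Submodule.subset_span
      ⟨_, Submodule.subset_span (by simp), _, Submodule.subset_span (by simp), _, ?_, rfl⟩)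
    apply basis_mem_aux
    rw [Finset.card_erase_of_mem hc', Finset.card_erase_of_mem ha]; omega

/-- For `s ≥ 1` with `2s ≤ n - 1`, the intersection
`Q_(n-1)(span{e_0,e_1}) ∩ ⋯ ∩ Q_(n-1)(span{e_(2s-2),e_(2s-1)})` inside `⋀^(n-1) V`
equals the span of the degree-`(n-1)` basis monomials divisible by
`e_0 ∧ e_1 ∧ ⋯ ∧ e_(2s-1)`. -/
theorem stmt4 {K V : Type*} [Field K] [CharZero K] [AddCommGroup V] [Module K V]
    {n : ℕ} (e : Module.Basis (Fin (n + 1)) K V) (s : ℕ) (hs : 1 ≤ s) (hsn : 2 * s ≤ n - 1) :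
    (⨅ j ∈ Finset.range s,
        Q K (n - 1) (Submodule.span K
          {e ((2 * j : ℕ) : Fin (n + 1)), e ((2 * j + 1 : ℕ) : Fin (n + 1))})) =
      Submodule.span K
        (expMonomial e ''
          {T : Finset (Fin (n + 1)) |
            T.card = n - 1 ∧ ∀ i : Fin (n + 1), (i : ℕ) < 2 * s → i ∈ T}) := by
  have hval : ∀ k, k < n + 1 → (((k : ℕ) : Fin (n + 1)) : ℕ) = k := fun k hk => by
    rw [Fin.val_natCast, Nat.mod_eq_of_lt hk]
  have hQ : ∀ j ∈ Finset.range s, Q K (n - 1) (Submodule.span K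
          {e ((2 * j : ℕ) : Fin (n + 1)), e ((2 * j + 1 : ℕ) : Fin (n + 1))}) =
      Submodule.span K (e.ExteriorAlgebra '' {T | T.card = n - 1 ∧
        ((2 * j : ℕ) : Fin (n + 1)) ∈ T ∧ ((2 * j + 1 : ℕ) : Fin (n + 1)) ∈ T}) := by
    intro j hj
    rw [Finset.mem_range] at hj
    refine Q_eq_aux e _ (by omega) _ _ ?_
    intro h
    have := congrArg Fin.val h
    rw [hval _ (by omega), hval _ (by omega)] at this
    omega
  have hE : expMonomial e = e.ExteriorAlgebra := funext (expMonomial_eq_basis e)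
  rw [hE]
  ext x
  simp only [Submodule.mem_iInf]
  rw [Module.Basis.mem_span_image]
  constructor
  · intro h T hT
    have h' : ∀ j ∈ Finset.range s, T.card = n - 1 ∧
        ((2 * j : ℕ) : Fin (n + 1)) ∈ T ∧ ((2 * j + 1 : ℕ) : Fin (n + 1)) ∈ T := by
      intro j hj
      have := h j hj
      rw [hQ j hj, Module.Basis.mem_span_image] at this
      exact this hT
    refine ⟨(h' 0 (Finset.mem_range.2 hs)).1, fun i hi => ?_⟩
    have hj := h' (i / 2) (Finset.mem_range.2 (by omega))
    rcases Nat.mod_two_eq_zero_or_one i with h0 | h0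
    · have : ((2 * ((i : ℕ) / 2) : ℕ) : Fin (n + 1)) = i := by
        apply Fin.ext
        rw [hval _ (by omega)]; omega
      exact this ▸ hj.2.1
    · have : ((2 * ((i : ℕ) / 2) + 1 : ℕ) : Fin (n + 1)) = i := by
        apply Fin.ext
        rw [hval _ (by omega)]; omega
      exact this ▸ hj.2.2
  · intro h j hj
    rw [hQ j hj, Module.Basis.mem_span_image]
    rw [Finset.mem_range] at hj
    intro T hT
    obtain ⟨h1, h2⟩ := h hT
    exact ⟨h1, h2 _ (by rw [hval _ (by omega)]; omega), h2 _ (by rw [hval _ (by omega)]; omega)⟩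
end

section
/- Let k ≥ 3 and s ≥ 1 satisfy ks ≤ n + 1 and 2s ≤ n + 1 − k. Then the intersection W = Q_{n+1−k}(span{e_0, …, e_{k−1}}) ∩ Q_{n+1−k}(span{e_k, …, e_{2k−1}}) ∩ … ∩ Q_{n+1−k}(span{e_{(s−1)k}, …, e_{sk−1}}) inside ⋀^{n+1−k} V has dimension exactly C(n+1, k) − s·(k(n+1−k) + 1). -/
open ExteriorAlgebra

section Helpers

variable {K V : Type*} [Field K] [AddCommGroup V] [Module K V]
  {I : Type*} [LinearOrder I]

lemma aux_mul_disj (b : Module.Basis I K V) (S T : Finset I) (h : Disjoint S T) :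
    ∃ u : ℤˣ, b.ExteriorAlgebra S * b.ExteriorAlgebra T = u • b.ExteriorAlgebra (S ∪ T) := by
  have := ExteriorAlgebra.basis_mul_of_disjoint b
    (⟨S, rfl⟩ : Set.powersetCard I S.card) (⟨T, rfl⟩ : Set.powersetCard I T.card) h
  rw [show ((Set.powersetCard.disjUnion (s := (⟨S, rfl⟩ : Set.powersetCard I S.card))
    (t := (⟨T, rfl⟩ : Set.powersetCard I T.card)) h : Set.powersetCard I _) : Finset I) = S ∪ T by
      simp [Set.powersetCard.disjUnion, Finset.disjUnion_eq_union]] at this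
  exact ⟨_, this⟩

lemma aux_mul_not_disj (b : Module.Basis I K V) (S T : Finset I) (h : ¬ Disjoint S T) :
    b.ExteriorAlgebra S * b.ExteriorAlgebra T = 0 :=
  ExteriorAlgebra.basis_mul_of_not_disjoint b
    (⟨S, rfl⟩ : Set.powersetCard I S.card) (⟨T, rfl⟩ : Set.powersetCard I T.card) h

lemma aux_single (b : Module.Basis I K V) (a : I) : b.ExteriorAlgebra {a} = ι K (b a) := by
  rw [ExteriorAlgebra.basis_apply_ofCard b (Finset.card_singleton a)]
  have h : (Set.powersetCard.ofFinEmbEquiv.symm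
      (Set.powersetCard.ofCard (Finset.card_singleton a))) 0 = a := by
    have h2 : (Set.powersetCard.ofFinEmbEquiv.symm
        (Set.powersetCard.ofCard (Finset.card_singleton a))) 0 ∈ ({a} : Finset I) := by
      rw [Set.powersetCard.ofFinEmbEquiv_symm_apply]
      exact Finset.orderEmbOfFin_mem _ _ _
    exact Finset.mem_singleton.1 h2
  simp [ExteriorAlgebra.ιMulti_family, ιMulti_apply, h]

lemma aux_power (b : Module.Basis I K V) (m : ℕ) :
    (⋀[K]^m V : Submodule K (ExteriorAlgebra K V)) =
      Submodule.span K (b.ExteriorAlgebra '' {S | S.card = m}) := by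
  rw [← exteriorPower.ιMulti_family_span_fixedDegree_of_span K b.span_eq]
  congr 1
  ext z
  constructor
  · rintro ⟨S, rfl⟩
    exact ⟨S.1, S.2, ExteriorAlgebra.basis_apply_powersetCard b S⟩
  · rintro ⟨S, hS, rfl⟩
    exact ⟨⟨S, hS⟩, (ExteriorAlgebra.basis_apply_powersetCard b ⟨S, hS⟩).symm⟩

lemma aux_unit (u : ℤˣ) (z : ExteriorAlgebra K V)
    (p : Submodule K (ExteriorAlgebra K V)) : u • z ∈ p ↔ z ∈ p := by
  rcases Int.units_eq_one_or u with rfl | rfl <;> simp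

lemma aux_Q (b : Module.Basis I K V) (d : ℕ) (hd : 2 ≤ d) (A : Finset I) :
    Q K d (Submodule.span K (b '' (A : Set I))) =
      Submodule.span K (b.ExteriorAlgebra '' {S | S.card = d ∧ 2 ≤ (S ∩ A).card}) := by
  apply le_antisymm
  · refine Submodule.span_le.2 ?_
    rintro z ⟨x, hx, y, hy, m, hm, rfl⟩
    rw [aux_power b] at hm
    simp only [SetLike.mem_coe]
    induction hx using Submodule.span_induction with
    | zero => simp
    | add x x' _ _ h h' => simpa [add_mul] using add_mem h h'
    | smul c x _ h => simpa using Submodule.smul_mem _ c h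
    | mem x hx =>
    obtain ⟨a, ha, rfl⟩ := hx
    induction hy using Submodule.span_induction with
    | zero => simp
    | add x x' _ _ h h' => simpa [add_mul, mul_add] using add_mem h h'
    | smul c x _ h => simpa using Submodule.smul_mem _ c h
    | mem x hx =>
    obtain ⟨a', ha', rfl⟩ := hx
    induction hm using Submodule.span_induction with
    | zero => simp
    | add x x' _ _ h h' => simpa [mul_add] using add_mem h h'
    | smul c x _ h => simpa using Submodule.smul_mem _ c h
    | mem x hx =>
    obtain ⟨T, hT, rfl⟩ := hx
    rw [← aux_single b, ← aux_single b]
    by_cases h1 : Disjoint ({a} : Finset I) {a'}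
    swap
    · simp [aux_mul_not_disj b _ _ h1]
    obtain ⟨u, hu⟩ := aux_mul_disj b _ _ h1
    rw [hu, smul_mul_assoc, aux_unit]
    by_cases h2 : Disjoint (({a} : Finset I) ∪ {a'}) T
    swap
    · rw [aux_mul_not_disj b _ _ h2]; exact Submodule.zero_mem _
    obtain ⟨u', hu'⟩ := aux_mul_disj b _ _ h2
    rw [hu', aux_unit]
    refine Submodule.subset_span ⟨_, ⟨?_, ?_⟩, rfl⟩
    · rw [Finset.card_union_of_disjoint h2, Finset.card_union_of_disjoint h1]
      simp only [Set.mem_ofPred_eq] at hT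
      simp; omega
    · have : ({a} : Finset I) ∪ {a'} ⊆ ({a} ∪ {a'} ∪ T) ∩ A := by
        intro i hi
        simp only [Finset.mem_union, Finset.mem_singleton, Finset.mem_inter] at hi ⊢
        rcases hi with rfl | rfl <;> simp_all
      refine le_trans ?_ (Finset.card_le_card this)
      rw [Finset.card_union_of_disjoint h1]; simp
  · refine Submodule.span_le.2 ?_
    rintro _ ⟨S, ⟨hS, hSA⟩, rfl⟩
    obtain ⟨a, ha, a', ha', hne⟩ := Finset.one_lt_card.1 hSA
    simp only [Finset.mem_inter] at ha ha'
    have h1 : Disjoint ({a} : Finset I) {a'} := by simpa using hne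
    have h2 : Disjoint (({a} : Finset I) ∪ {a'}) (S \ ({a} ∪ {a'})) := Finset.disjoint_sdiff
    have hsub : ({a} : Finset I) ∪ {a'} ⊆ S := by
      intro i hi
      simp only [Finset.mem_union, Finset.mem_singleton] at hi
      rcases hi with rfl | rfl
      exacts [ha.1, ha'.1]
    obtain ⟨u, hu⟩ := aux_mul_disj b _ _ h1
    obtain ⟨u', hu'⟩ := aux_mul_disj b _ _ h2
    rw [Finset.union_sdiff_of_subset hsub] at hu'
    have hc : (S \ ({a} ∪ {a'})).card = d - 2 := by
      rw [Finset.card_sdiff_of_subset hsub, Finset.card_union_of_disjoint h1, hS]; simp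
    have : ι K (b a) * ι K (b a') * b.ExteriorAlgebra (S \ ({a} ∪ {a'})) ∈
        Q K d (Submodule.span K (b '' (A : Set I))) := by
      refine Submodule.subset_span ⟨_, Submodule.subset_span ⟨a, ha.2, rfl⟩, _,
        Submodule.subset_span ⟨a', ha'.2, rfl⟩, _, ?_, rfl⟩
      rw [aux_power b]
      exact Submodule.subset_span ⟨_, hc, rfl⟩
    rw [← aux_single b, ← aux_single b, hu, smul_mul_assoc, aux_unit, hu', aux_unit] at this
    exact this

lemma aux_bad {J : Type*} [Fintype J] [DecidableEq J] (A : Finset J) :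
    ((Finset.univ : Finset (Finset J)).filter
      (fun S => S.card = Aᶜ.card ∧ (S ∩ A).card < 2)).card = A.card * Aᶜ.card + 1 := by
  classical
  have key : (Finset.univ : Finset (Finset J)).filter
      (fun S => S.card = Aᶜ.card ∧ (S ∩ A).card < 2) =
      insert Aᶜ ((A ×ˢ Aᶜ).image (fun p => insert p.1 (Aᶜ.erase p.2))) := by
    ext S
    simp only [Finset.mem_filter, Finset.mem_univ, true_and, Finset.mem_insert, Finset.mem_image,
      Finset.mem_product, Prod.exists]
    constructor
    · rintro ⟨hS, hSA⟩
      have hsplit := Finset.card_inter_add_card_sdiff S A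
      have hSc : S \ A ⊆ Aᶜ := fun i hi => by simp at hi ⊢; exact hi.2
      interval_cases h : (S ∩ A).card
      · left
        have h3 : S \ A = Aᶜ := Finset.eq_of_subset_of_card_le hSc (by omega)
        rw [Finset.card_eq_zero] at h
        rw [← h3, eq_comm, Finset.sdiff_eq_self_iff_disjoint, Finset.disjoint_iff_inter_eq_empty, h]
      · right
        obtain ⟨a, ha⟩ := Finset.card_eq_one.1 h
        have h4 : (Aᶜ \ (S \ A)).card = 1 := by
          rw [Finset.card_sdiff_of_subset hSc]; omega
        obtain ⟨c, hc⟩ := Finset.card_eq_one.1 h4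
        refine ⟨a, c, ⟨?_, ?_⟩, ?_⟩
        · exact (Finset.mem_inter.1 (ha ▸ Finset.mem_singleton_self a)).2
        · exact (Finset.mem_sdiff.1 (hc ▸ Finset.mem_singleton_self c)).1
        · ext i
          have e1 := congrArg (i ∈ ·) ha
          have e2 := congrArg (i ∈ ·) hc
          simp at e1 e2 ⊢
          grind
    · rintro (rfl | ⟨a, c, ⟨ha, hc⟩, rfl⟩)
      · refine ⟨rfl, ?_⟩
        have h0 : Aᶜ ∩ A = ∅ := by
          ext i; simp
        rw [h0]; simp
      · have hc' := Finset.card_pos.2 ⟨c, hc⟩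
        constructor
        · rw [Finset.card_insert_of_notMem, Finset.card_erase_of_mem hc]
          · omega
          · simp [ha]
        · have : insert a (Aᶜ.erase c) ∩ A ⊆ {a} := by
            intro i hi
            simp at hi ⊢
            tauto
          have := Finset.card_le_card this
          simp at this; omega
  rw [key, Finset.card_insert_of_notMem, Finset.card_image_of_injOn, Finset.card_product]
  · rintro ⟨a, c⟩ h ⟨a', c'⟩ h' heq
    simp only [Finset.coe_product, Set.mem_prod, Finset.mem_coe, Finset.mem_compl] at h h' heq
    have e1 := congrArg (a ∈ ·) heq
    have e2 := congrArg (c ∈ ·) heq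
    simp at e1 e2 ⊢
    grind
  · simp only [Finset.mem_image, Finset.mem_product, Prod.exists, not_exists]
    rintro a c ⟨⟨ha, hc⟩, h⟩
    have := congrArg (a ∈ ·) h
    simp at this
    exact this ha

end Helpers

/-- For `k ≥ 3`, `s ≥ 1` with `ks ≤ n + 1` and `2s ≤ n + 1 - k`, the intersection
`W = Q_(n+1-k)(span{e_0,…,e_(k-1)}) ∩ ⋯ ∩ Q_(n+1-k)(span{e_((s-1)k),…,e_(sk-1)})`
inside `⋀^(n+1-k) V` has dimension exactly `C(n+1, k) - s·(k(n+1-k) + 1)`. -/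
theorem stmt7 {K V : Type*} [Field K] [CharZero K] [AddCommGroup V] [Module K V]
    {n : ℕ} (e : Module.Basis (Fin (n + 1)) K V) (k s : ℕ) (hk : 3 ≤ k) (hs : 1 ≤ s)
    (hks : k * s ≤ n + 1) (h2s : 2 * s ≤ n + 1 - k) :
    (Module.finrank K
        ↥(⨅ j ∈ Finset.range s,
          Q K (n + 1 - k)
            (Submodule.span K
              (e '' {i : Fin (n + 1) | j * k ≤ (i : ℕ) ∧ (i : ℕ) < j * k + k}))) : ℤ) =
      (Nat.choose (n + 1) k : ℤ) - s * (k * (n + 1 - k) + 1) := by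
  classical
  set B := e.ExteriorAlgebra with hB
  let A : ℕ → Finset (Fin (n + 1)) := fun j =>
    Finset.univ.filter (fun i => j * k ≤ (i : ℕ) ∧ (i : ℕ) < j * k + k)
  have hkn : k ≤ n + 1 := by omega
  have hA : ∀ j ∈ Finset.range s, (A j).card = k := by
    intro j hj
    have hj' : j + 1 ≤ s := Finset.mem_range.1 hj
    have hle : j * k + k ≤ n + 1 := by nlinarith
    have : (A j).map Fin.valEmbedding = Finset.Ico (j * k) (j * k + k) := by
      ext i
      simp only [A, Finset.mem_map, Finset.mem_filter, Finset.mem_univ, true_and,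
        Fin.valEmbedding_apply, Finset.mem_Ico]
      constructor
      · rintro ⟨a, h, rfl⟩; exact h
      · intro h; exact ⟨⟨i, by omega⟩, h, rfl⟩
    rw [← Finset.card_map Fin.valEmbedding, this]; simp
  have hAc : ∀ j ∈ Finset.range s, (A j)ᶜ.card = n + 1 - k := by
    intro j hj
    rw [Finset.card_compl, hA j hj, Fintype.card_fin]
  have hdisj : ∀ i j, i ≠ j → Disjoint (A i) (A j) := by
    intro i j hij
    rw [Finset.disjoint_left]
    intro a ha hb
    simp only [A, Finset.mem_filter, Finset.mem_univ, true_and] at ha hb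
    rcases lt_or_gt_of_ne hij with h | h
    · nlinarith
    · nlinarith
  set G : Finset (Finset (Fin (n + 1))) := Finset.univ.filter
    (fun S => S.card = n + 1 - k ∧ ∀ j ∈ Finset.range s, 2 ≤ (S ∩ A j).card) with hG
  have hW : (⨅ j ∈ Finset.range s, Q K (n + 1 - k) (Submodule.span K
      (e '' {i : Fin (n + 1) | j * k ≤ (i : ℕ) ∧ (i : ℕ) < j * k + k}))) =
      Submodule.span K (B '' (G : Set (Finset (Fin (n + 1))))) := by
    have h1 : ∀ j, Q K (n + 1 - k) (Submodule.span K
        (e '' {i : Fin (n + 1) | j * k ≤ (i : ℕ) ∧ (i : ℕ) < j * k + k})) =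
        Submodule.span K (B '' {S | S.card = n + 1 - k ∧ 2 ≤ (S ∩ A j).card}) := by
      intro j
      rw [← aux_Q e (n + 1 - k) (by omega) (A j)]
      simp [A]
    ext z
    simp only [h1, Submodule.mem_iInf, B.mem_span_image]
    constructor
    · intro h S hS
      simp only [hG, Finset.coe_filter, Finset.mem_univ, true_and, Set.mem_ofPred_eq]
      exact ⟨(h 0 (Finset.mem_range.2 hs) hS).1, fun j hj => (h j hj hS).2⟩
    · intro h j hj S hS
      have := h hS
      simp only [hG, Finset.coe_filter, Finset.mem_univ, true_and, Set.mem_ofPred_eq] at this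
      exact ⟨this.1, this.2 j hj⟩
  have hrank : Module.finrank K (Submodule.span K (B '' (G : Set (Finset (Fin (n + 1)))))) =
      G.card := by
    rw [← Finset.coe_image, finrank_span_finset_eq_card, Finset.card_image_of_injective _ B.injective]
    rw [Finset.coe_image]
    exact B.linearIndependent.linearIndepOn_id.mono (Set.image_subset_range _ _)
  rw [hW, hrank]
  let bad : ℕ → Finset (Finset (Fin (n + 1))) := fun j => Finset.univ.filter
    (fun S => S.card = n + 1 - k ∧ (S ∩ A j).card < 2)
  have hbad : ∀ j ∈ Finset.range s, (bad j).card = k * (n + 1 - k) + 1 := by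
    intro j hj
    have := aux_bad (A j)
    rw [hAc j hj, hA j hj] at this
    exact this
  have hbd : ∀ i ∈ Finset.range s, ∀ j ∈ Finset.range s, i ≠ j → Disjoint (bad i) (bad j) := by
    intro i hi j hj hij
    rw [Finset.disjoint_left]
    intro S h1 h2
    simp only [bad, Finset.mem_filter, Finset.mem_univ, true_and] at h1 h2
    have c1 := Finset.card_inter_add_card_sdiff (A i) S
    have c2 := Finset.card_inter_add_card_sdiff (A j) S
    rw [Finset.inter_comm, hA i hi] at c1
    rw [Finset.inter_comm, hA j hj] at c2
    have hsub : (A i \ S) ∪ (A j \ S) ⊆ Sᶜ := by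
      intro a ha
      simp at ha ⊢
      tauto
    have hc := Finset.card_le_card hsub
    rw [Finset.card_union_of_disjoint (Finset.disjoint_of_subset_left Finset.sdiff_subset
      (Finset.disjoint_of_subset_right Finset.sdiff_subset (hdisj i j hij))),
      Finset.card_compl, Fintype.card_fin, h1.1] at hc
    omega
  have htot : G.card + ((Finset.range s).biUnion bad).card = (n + 1).choose k := by
    rw [← Finset.card_union_of_disjoint]
    · have : G ∪ (Finset.range s).biUnion bad =
          Finset.powersetCard (n + 1 - k) Finset.univ := by
        ext S
        simp only [hG, bad, Finset.mem_union, Finset.mem_filter, Finset.mem_univ, true_and,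
          Finset.mem_biUnion, Finset.mem_powersetCard, Finset.subset_univ]
        constructor
        · rintro (h | ⟨j, _, h⟩)
          exacts [h.1, h.1]
        · intro h
          by_cases h' : ∀ j ∈ Finset.range s, 2 ≤ (S ∩ A j).card
          · exact Or.inl ⟨h, h'⟩
          · push Not at h'
            obtain ⟨j, hj, h'⟩ := h'
            exact Or.inr ⟨j, hj, h, h'⟩
      rw [this, Finset.card_powersetCard, Finset.card_univ, Fintype.card_fin,
        Nat.choose_symm hkn]
    · rw [Finset.disjoint_left]
      intro S h1 h2
      simp only [hG, bad, Finset.mem_filter, Finset.mem_univ, true_and,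
          Finset.mem_biUnion] at h1 h2
      obtain ⟨j, hj, h2⟩ := h2
      have := h1.2 j hj
      omega
  rw [Finset.card_biUnion hbd, Finset.sum_congr rfl hbad, Finset.sum_const, Finset.card_range,
    smul_eq_mul] at htot
  have := congrArg (Nat.cast : ℕ → ℤ) htot
  push_cast [Nat.cast_sub hkn] at this
  linarith
end

section
/- Let V be an 8-dimensional vector space over a field K of characteristic zero with basis e_0, …, e_7, and set H_1 = span{e_0, e_1, e_2, e_3}, H_2 = span{e_4, e_5, e_6, e_7}, H_3 = span{e_0 + e_4, e_1 + e_5, e_2 + e_6, e_3 + e_7}. Then the intersection W = Q_4(H_1) ∩ Q_4(H_2) ∩ Q_4(H_3) inside ⋀^4 V has dimension exactly 20. -/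
open ExteriorAlgebra

namespace Stmt12Aux

/-- Covector evaluated on a coordinate vector: `x k`, or `x k - x (k+4)`. -/
def cv {R : Type*} [CommRing R] (p : Fin 8 × Bool) (x : Fin 8 → R) : R :=
  if p.2 then x p.1 - x (p.1 + 4) else x p.1

/-- Explicit `4 × 4` determinant (Laplace expansion along the first two rows). -/
def d4 {R : Type*} [CommRing R] (M : Fin 4 → Fin 4 → R) : R :=
  (M 0 0 * M 1 1 - M 0 1 * M 1 0) * (M 2 2 * M 3 3 - M 2 3 * M 3 2)
  - (M 0 0 * M 1 2 - M 0 2 * M 1 0) * (M 2 1 * M 3 3 - M 2 3 * M 3 1)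
  + (M 0 0 * M 1 3 - M 0 3 * M 1 0) * (M 2 1 * M 3 2 - M 2 2 * M 3 1)
  + (M 0 1 * M 1 2 - M 0 2 * M 1 1) * (M 2 0 * M 3 3 - M 2 3 * M 3 0)
  - (M 0 1 * M 1 3 - M 0 3 * M 1 1) * (M 2 0 * M 3 2 - M 2 2 * M 3 0)
  + (M 0 2 * M 1 3 - M 0 3 * M 1 2) * (M 2 0 * M 3 1 - M 2 1 * M 3 0)

lemma det_eq_d4 {R : Type*} [CommRing R] (M : Matrix (Fin 4) (Fin 4) R) :
    M.det = d4 M := by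
  simp [Matrix.det_succ_row_zero, Fin.sum_univ_succ, Fin.succAbove, d4]
  ring

/-- Integer standard basis vector. -/
def sg (n : Fin 8) : Fin 8 → ℤ := fun k => if k.val = n.val then 1 else 0

/-- The pairing of four covectors with four vectors. -/
def pr (u : Fin 4 → Fin 8 × Bool) (x : Fin 4 → Fin 8 → ℤ) : ℤ :=
  d4 (fun i j => cv (u i) (x j))

/-- Triples in `{0,1,2,3}`. -/
def triples : List (Fin 8 × Fin 8 × Fin 8) := [(0, 1, 2), (0, 1, 3), (0, 2, 3), (1, 2, 3)]

/-- All triples up to the order of the last two entries. -/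
def triplesRot : List (Fin 8 × Fin 8 × Fin 8) :=
  triples.flatMap fun t => [(t.1, t.2.1, t.2.2), (t.2.1, t.2.2, t.1), (t.2.2, t.1, t.2.1)]

/-- Index tuples of the coordinates killing `Q 4 H₁`. -/
def ind1 : List (Fin 4 → Fin 8) :=
  ![4, 5, 6, 7] :: triples.flatMap fun t =>
    [0, 1, 2, 3].map fun a => ![a, t.1 + 4, t.2.1 + 4, t.2.2 + 4]

/-- Index tuples of the coordinates killing `Q 4 H₂`. -/
def ind2 : List (Fin 4 → Fin 8) :=
  ![0, 1, 2, 3] :: triples.flatMap fun t =>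
    [4, 5, 6, 7].map fun a => ![a, t.1, t.2.1, t.2.2]

/-- Orderings `(d, o, j, k)` of `0,1,2,3` with each `d` once. -/
def quads : List (Fin 8 × Fin 8 × Fin 8 × Fin 8) :=
  [(0, 1, 2, 3), (1, 2, 3, 0), (2, 3, 0, 1), (3, 0, 1, 2)]

/-- Functionals killing `Q 4 H₁`. -/
def fun1 : List (Fin 4 → Fin 8 × Bool) := ind1.map fun w i => (w i, false)

/-- Functionals killing `Q 4 H₂`. -/
def fun2 : List (Fin 4 → Fin 8 × Bool) := ind2.map fun w i => (w i, false)

/-- Functionals killing `Q 4 H₃`. -/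
def fun3 : List (Fin 4 → Fin 8 × Bool) :=
  (quads.map fun q => ![(q.2.1, true), (q.2.2.1, true), (q.2.2.2, true), (q.1 + 4, false)]) ++
  (triplesRot.map fun t => ![(t.1, true), (t.2.1, true), (t.2.2, true), (t.1 + 4, false)])

/-- The 50 functionals. -/
def F50 : List (Fin 4 → Fin 8 × Bool) := (fun1 ++ fun2) ++ fun3

/-- The 50 vectors, dual to the functionals in a triangular way. -/
def V50 : List (Fin 4 → Fin 8 → ℤ) :=
  ((ind1.map fun w i => sg (w i)) ++ (ind2.map fun w i => sg (w i))) ++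
  ((quads.map fun q => ![sg q.2.1, fun k => sg q.1 k + sg q.2.2.1 k + sg q.2.2.2 k,
      fun k => sg (q.1 + 4) k + sg (q.2.2.2 + 4) k,
      fun k => sg (q.2.2.2 + 4) k - sg (q.2.2.1 + 4) k]) ++
  (triplesRot.map fun t => ![sg t.1, sg t.2.1, sg (t.1 + 4), sg (t.2.2 + 4)]))

/-- Pairs `x, y` (as sums of at most two basis vectors of `H₁`) with wedge `x y xp yp`, together with
a coordinate. -/
def L20 : List (((Fin 8 × Fin 8) × (Fin 8 × Fin 8)) × (Fin 4 → Fin 8)) :=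
  [(((0, 1), (2, 3)), ![0, 2, 5, 7]), (((0, 2), (1, 3)), ![0, 1, 6, 7])] ++
  (triplesRot.map fun t => (((t.1, t.1), (t.2.1, t.2.2)), ![t.1, t.2.1, t.1 + 4, t.2.2 + 4])) ++
  ([(0, 1), (0, 2), (0, 3), (1, 2), (1, 3), (2, 3)].map fun p =>
    (((p.1, p.1), (p.2, p.2)), ![p.1, p.2, p.1 + 4, p.2 + 4]))

/-- `e_a + e_b`. -/
def s2 (a b : Fin 8) : Fin 8 → ℤ := fun k => sg a k + sg b k

/-- Default entry. -/
def dflt : ((Fin 8 × Fin 8) × (Fin 8 × Fin 8)) × (Fin 4 → Fin 8) := (((0, 0), (0, 0)), fun _ => 0)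

/-- The 20 vectors. -/
def vec20 (i : Fin 20) : Fin 4 → Fin 8 → ℤ :=
  let p := (L20.getD i.val dflt).1
  ![s2 p.1.1 p.1.2, s2 p.2.1 p.2.2, s2 (p.1.1 + 4) (p.1.2 + 4), s2 (p.2.1 + 4) (p.2.2 + 4)]

/-- The 20 functionals. -/
def fun20 (i : Fin 20) : Fin 4 → Fin 8 × Bool := fun k => ((L20.getD i.val dflt).2 k, false)

/-- The 50 vectors. -/
def vec50 (i : Fin 50) : Fin 4 → Fin 8 → ℤ := V50.getD i.val (fun _ _ => 0)

/-- The 50 functionals. -/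
def fun50 (i : Fin 50) : Fin 4 → Fin 8 × Bool := F50.getD i.val (fun _ => (0, false))

lemma tri50 : ∀ i j : Fin 50, i < j → pr (fun50 i) (vec50 j) = 0 := by decide +kernel

lemma diag50 : ∀ i : Fin 50, pr (fun50 i) (vec50 i) ≠ 0 := by decide +kernel

lemma tri20 : ∀ i j : Fin 20, i < j → pr (fun20 i) (vec20 j) = 0 := by decide +kernel

lemma diag20 : ∀ i : Fin 20, pr (fun20 i) (vec20 i) ≠ 0 := by decide +kernel

/-- Generators of the three subspaces. -/
def gen : Fin 3 → Fin 4 → Fin 8 → ℤ :=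
  ![fun i => sg (i.castLE (by decide)), fun i => sg (i.castLE (by decide) + 4),
    fun i k => sg (i.castLE (by decide)) k + sg (i.castLE (by decide) + 4) k]

lemma kill50 : ∀ i : Fin 50, ∃ h : Fin 3, ∃ i0 : Fin 4, ∀ k : Fin 4, k ≠ i0 →
    ∀ g : Fin 4, cv (fun50 i k) (gen h g) = 0 := by decide +kernel

lemma idx20 : ∀ i : Fin 20, (L20.getD i.val dflt).1.1.1 < 4 ∧ (L20.getD i.val dflt).1.1.2 < 4 ∧
    (L20.getD i.val dflt).1.2.1 < 4 ∧ (L20.getD i.val dflt).1.2.2 < 4 := by decide +kernel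


section
variable {K V : Type*} [Field K] [AddCommGroup V] [Module K V] (e : Module.Basis (Fin 8) K V)

/-- The vector with the given integer coordinates. -/
noncomputable def vv (x : Fin 8 → ℤ) : V := ∑ k, (x k : K) • e k

lemma coord_vv (x : Fin 8 → ℤ) (k : Fin 8) : e.coord k (vv e x) = (x k : K) := by
  simp [vv, Finsupp.single_apply]

lemma vv_sg (n : Fin 8) : vv e (sg n) = e n := by
  simp only [vv, sg]
  rw [Finset.sum_eq_single n]
  · simp
  · intro b _ hb
    have : b.val ≠ n.val := fun h => hb (Fin.ext h)
    simp [this]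
  · simp

lemma vv_add (x y : Fin 8 → ℤ) : vv e (fun k => x k + y k) = vv e x + vv e y := by
  simp [vv, add_smul, Finset.sum_add_distrib]

/-- Covector on `V`. -/
noncomputable def cvl (p : Fin 8 × Bool) : V →ₗ[K] K :=
  if p.2 then e.coord p.1 - e.coord (p.1 + 4) else e.coord p.1

lemma cvl_vv (p : Fin 8 × Bool) (x : Fin 8 → ℤ) : cvl e p (vv e x) = ((cv p x : ℤ) : K) := by
  unfold cvl cv
  split_ifs
  · rw [LinearMap.sub_apply, coord_vv, coord_vv]; push_cast; rfl
  · rw [coord_vv]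

/-- The alternating form attached to four covectors. -/
noncomputable def alt (u : Fin 4 → Fin 8 × Bool) : V [⋀^Fin 4]→ₗ[K] K :=
  (Matrix.detRowAlternating (R := K) (n := Fin 4)).compLinearMap
    (LinearMap.pi fun i => cvl e (u i))

lemma alt_apply (u : Fin 4 → Fin 8 × Bool) (v : Fin 4 → V) :
    alt e u v = d4 (fun i j => cvl e (u i) (v j)) := by
  have : alt e u v = Matrix.det (Matrix.of fun j i => cvl e (u i) (v j)) := rfl
  rw [this, ← Matrix.det_transpose, det_eq_d4]
  rfl

/-- The functional on the exterior algebra. -/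
noncomputable def fnl (u : Fin 4 → Fin 8 × Bool) : ExteriorAlgebra K V →ₗ[K] K :=
  liftAlternating (Pi.single 4 (alt e u))

lemma fnl_apply (u : Fin 4 → Fin 8 × Bool) (v : Fin 4 → V) :
    fnl e u (ιMulti K 4 v) = d4 (fun i j => cvl e (u i) (v j)) := by
  rw [fnl, liftAlternating_apply_ιMulti, Pi.single_eq_same, alt_apply]

lemma fnl_vv (u : Fin 4 → Fin 8 × Bool) (x : Fin 4 → Fin 8 → ℤ) :
    fnl e u (ιMulti K 4 fun j => vv e (x j)) = ((pr u x : ℤ) : K) := by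
  rw [fnl_apply]
  simp only [cvl_vv, pr, d4]
  push_cast
  rfl

lemma d4_zero (M : Fin 4 → Fin 4 → K) (i0 : Fin 4)
    (h : ∀ k, k ≠ i0 → M k 0 = 0 ∧ M k 1 = 0) : d4 M = 0 := by
  have h0 := h 0
  have h1 := h 1
  have h2 := h 2
  have h3 := h 3
  unfold d4
  fin_cases i0 <;> simp at h0 h1 h2 h3 <;> simp [h0, h1, h2, h3]

lemma fnl_kill (u : Fin 4 → Fin 8 × Bool) (H : Submodule K V) (i0 : Fin 4)
    (h : ∀ k, k ≠ i0 → ∀ x ∈ H, cvl e (u k) x = 0) : Q K 4 H ≤ LinearMap.ker (fnl e u) := by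
  refine Submodule.span_le.2 ?_
  rintro z ⟨x, hx, y, hy, m, hm, rfl⟩
  change m ∈ ⋀[K]^2 V at hm
  rw [← ιMulti_span_fixedDegree] at hm
  rw [SetLike.mem_coe, LinearMap.mem_ker]
  induction hm using Submodule.span_induction with
  | mem m hm =>
    obtain ⟨a, rfl⟩ := hm
    have : ι K x * ι K y * ιMulti K 2 a = ιMulti K 4 ![x, y, a 0, a 1] := by
      simp [ιMulti_apply, mul_assoc]
      rfl
    rw [this, fnl_apply]
    exact d4_zero _ i0 fun k hk => ⟨h k hk x hx, h k hk y hy⟩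
  | zero => simp
  | add a b _ _ ha hb => rw [mul_add, map_add, ha, hb, add_zero]
  | smul c a _ ha => rw [mul_smul_comm, map_smul, ha, smul_zero]

lemma Q_le (H : Submodule K V) : Q K 4 H ≤ ⋀[K]^4 V := by
  refine Submodule.span_le.2 ?_
  rintro z ⟨x, hx, y, hy, m, hm, rfl⟩
  change m ∈ ⋀[K]^2 V at hm
  have h1 : ∀ x : V, ι K x ∈ ⋀[K]^1 V := fun x => by
    simp [exteriorPower]
  exact SetLike.mul_mem_graded (A := fun i : ℕ => ⋀[K]^i V)
    (SetLike.mul_mem_graded (A := fun i : ℕ => ⋀[K]^i V) (h1 x) (h1 y)) hm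

lemma tri_inj [CharZero K] {n : ℕ} (A : Fin n → Fin n → ℤ) (h : ∀ i j, i < j → A i j = 0)
    (hd : ∀ i, A i i ≠ 0) (c : Fin n → K) (hc : ∀ i, ∑ j, c j * (A i j : K) = 0) : c = 0 := by
  let M : Matrix (Fin n) (Fin n) K := Matrix.of fun i j => (A i j : K)
  have hM : M.det ≠ 0 := by
    rw [Matrix.det_of_isLowerTriangular M (fun i j hij => by
      have : i < j := hij
      simp [M, h i j this])]
    exact Finset.prod_ne_zero_iff.2 fun i _ => by simp [M, hd i]
  refine Matrix.eq_zero_of_mulVec_eq_zero hM ?_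
  ext i
  simpa [M, Matrix.mulVec, dotProduct, mul_comm] using hc i

lemma indep [CharZero K] {n : ℕ} (f : Fin n → Fin 4 → Fin 8 × Bool) (x : Fin n → Fin 4 → Fin 8 → ℤ)
    (h : ∀ i j, i < j → pr (f i) (x j) = 0) (hd : ∀ i, pr (f i) (x i) ≠ 0) (c : Fin n → K)
    (hc : ∀ i, fnl e (f i) (∑ j, c j • ιMulti K 4 fun k => vv e (x j k)) = 0) : c = 0 := by
  refine tri_inj (fun i j => pr (f i) (x j)) h hd c fun i => ?_
  have := hc i
  simpa only [map_sum, map_smul, fnl_vv, smul_eq_mul] using this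

lemma linInd [CharZero K] {n : ℕ} (f : Fin n → Fin 4 → Fin 8 × Bool)
    (x : Fin n → Fin 4 → Fin 8 → ℤ)
    (h : ∀ i j, i < j → pr (f i) (x j) = 0) (hd : ∀ i, pr (f i) (x i) ≠ 0) :
    LinearIndependent K fun j => ιMulti K 4 fun k => vv e (x j k) := by
  rw [Fintype.linearIndependent_iff]
  intro c hc i
  rw [indep e f x h hd c fun i => by rw [hc, map_zero]]
  rfl

lemma cvl_kill (p : Fin 8 × Bool) (g : Fin 4 → Fin 8 → ℤ) (h : ∀ i, cv p (g i) = 0)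
    (x : V) (hx : x ∈ Submodule.span K (Set.range fun i => vv e (g i))) : cvl e p x = 0 := by
  have : Submodule.span K (Set.range fun i => vv e (g i)) ≤ LinearMap.ker (cvl e p) := by
    refine Submodule.span_le.2 ?_
    rintro _ ⟨i, rfl⟩
    simp [cvl_vv, h]
  exact this hx

lemma mem_all (H₁ H₂ H₃ : Submodule K V) (x y xp yp : V) (hx : x ∈ H₁) (hy : y ∈ H₁)
    (hxp : xp ∈ H₂) (hyp : yp ∈ H₂) (h : x + xp ∈ H₃) (hp : y + yp ∈ H₃) :
    ιMulti K 4 ![x, y, xp, yp] ∈ Q K 4 H₁ ⊓ Q K 4 H₂ ⊓ Q K 4 H₃ := by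
  have m2 : ∀ a b : V, ι K a * ι K b ∈ ⋀[K]^(4-2) V := fun a b => by
    have : ι K a * ι K b = ιMulti K 2 ![a, b] := by simp [ιMulti_apply]
    rw [this]
    exact ιMulti_range K 2 ⟨_, rfl⟩
  have e0 : ιMulti K 4 ![x, y, xp, yp] = ι K x * ι K y * (ι K xp * ι K yp) := by
    simp [ιMulti_apply, mul_assoc]
  have sw : ∀ a b : V, ι K a * ι K b = - (ι K b * ι K a) := fun a b =>
    eq_neg_of_add_eq_zero_left (ι_add_mul_swap a b)
  have e1 : ι K x * ι K y * (ι K xp * ι K yp) = ι K xp * ι K yp * (ι K x * ι K y) := by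
    calc _ = ι K x * (ι K y * ι K xp) * ι K yp := by simp only [mul_assoc]
      _ = - ((ι K x * ι K xp) * (ι K y * ι K yp)) := by rw [sw y xp]; simp only [mul_assoc, mul_neg, neg_mul]
      _ = - (ι K xp * (ι K x * ι K yp) * ι K y) := by
        rw [sw x xp, sw y yp]; simp only [mul_assoc, mul_neg, neg_mul, neg_neg]
      _ = _ := by rw [sw x yp]; simp only [mul_assoc, mul_neg, neg_mul, neg_neg]
  have z1 : ∀ a b : V, ι K a * (ι K b * (ι K a)) = 0 := fun a b => by
    rw [sw b a, mul_neg, ← mul_assoc, ι_sq_zero, zero_mul, neg_zero]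
  have z2 : ∀ a : V, ∀ w, ι K a * (ι K a * w) = 0 := fun a w => by
    rw [← mul_assoc, ι_sq_zero, zero_mul]
  have z3 : ∀ a b : V, ∀ w, ι K a * (ι K b * (ι K a * w)) = 0 := fun a b w => by
    rw [← mul_assoc (ι K b), ← mul_assoc, z1, zero_mul]
  have e2 : ι K x * ι K y * (ι K xp * ι K yp) =
      ι K (x + xp) * ι K (y + yp) * (ι K xp * ι K yp) := by
    simp only [map_add, add_mul, mul_add, mul_assoc, z1, z3, mul_zero, add_zero]
  refine ⟨⟨?_, ?_⟩, ?_⟩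
  · exact Submodule.subset_span ⟨x, hx, y, hy, _, m2 xp yp, e0⟩
  · exact Submodule.subset_span ⟨xp, hxp, yp, hyp, _, m2 x y, e0.trans e1⟩
  · exact Submodule.subset_span ⟨_, h, _, hp, _, m2 xp yp, e0.trans e2⟩

lemma vv_s2 (a b : Fin 8) : vv e (s2 a b) = e a + e b := by
  rw [← vv_sg e a, ← vv_sg e b, ← vv_add]; rfl

lemma finrank_E (e : Module.Basis (Fin 8) K V) : Module.finrank K (⋀[K]^4 V) = 70 := by
  have : Module.Finite K V := Module.Finite.of_basis e
  rw [exteriorPower.finrank_eq, Module.finrank_eq_card_basis e]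
  rfl

end

end Stmt12Aux

open Stmt12Aux in
theorem stmt12 {K V : Type*} [Field K] [CharZero K] [AddCommGroup V] [Module K V]
    (e : Module.Basis (Fin 8) K V)
    (H₁ H₂ H₃ : Submodule K V)
    (hH₁ : H₁ = Submodule.span K {e 0, e 1, e 2, e 3})
    (hH₂ : H₂ = Submodule.span K {e 4, e 5, e 6, e 7})
    (hH₃ : H₃ = Submodule.span K {e 0 + e 4, e 1 + e 5, e 2 + e 6, e 3 + e 7}) :
    Module.finrank K ↥(Q K 4 H₁ ⊓ Q K 4 H₂ ⊓ Q K 4 H₃) = 20 := by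
  have : Module.Finite K V := Module.Finite.of_basis e
  have hE := finrank_E e
  have : Module.Finite K (⋀[K]^4 V) := inferInstance
  have g1 : H₁ = Submodule.span K (Set.range fun i => vv e (gen 0 i)) := by
    rw [hH₁]; congr 1; ext z
    simp [gen, vv_sg, Fin.exists_fin_succ, eq_comm, Fin.castLE]
  have g2 : H₂ = Submodule.span K (Set.range fun i => vv e (gen 1 i)) := by
    rw [hH₂]; congr 1; ext z
    simp [gen, vv_sg, Fin.exists_fin_succ, eq_comm, Fin.castLE]
  have g3 : H₃ = Submodule.span K (Set.range fun i => vv e (gen 2 i)) := by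
    rw [hH₃]; congr 1; ext z
    simp [gen, vv_sg, vv_add, Fin.exists_fin_succ, eq_comm, Fin.castLE]
  set W := Q K 4 H₁ ⊓ Q K 4 H₂ ⊓ Q K 4 H₃ with hW
  have hWE : W ≤ ⋀[K]^4 V := inf_le_right.trans (Q_le H₃)
  have hWfin : Module.Finite K W := Submodule.finiteDimensional_of_le hWE
  apply le_antisymm
  · -- upper bound
    let v : Fin 50 → ExteriorAlgebra K V := fun j => ιMulti K 4 fun k => vv e (vec50 j k)
    have hv : LinearIndependent K v := linInd e fun50 vec50 tri50 diag50
    have hUE : Submodule.span K (Set.range v) ≤ ⋀[K]^4 V := by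
      refine Submodule.span_le.2 ?_
      rintro _ ⟨i, rfl⟩
      exact ιMulti_range K 4 ⟨_, rfl⟩
    have hk : ∀ i, W ≤ LinearMap.ker (fnl e (fun50 i)) := by
      intro i
      obtain ⟨h, i0, hi⟩ := kill50 i
      have key := fnl_kill e (fun50 i) (Submodule.span K (Set.range fun j => vv e (gen h j))) i0
        fun k hk x hx => cvl_kill e _ _ (hi k hk) x hx
      fin_cases h
      · exact (inf_le_left.trans inf_le_left).trans (g1 ▸ key)
      · exact (inf_le_left.trans inf_le_right).trans (g2 ▸ key)
      · exact inf_le_right.trans (g3 ▸ key)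
    have hdis : W ⊓ Submodule.span K (Set.range v) = ⊥ := by
      rw [eq_bot_iff]
      rintro z ⟨hz, hzp⟩
      obtain ⟨c, rfl⟩ := (Submodule.mem_span_range_iff_exists_fun K).1 hzp
      have : c = 0 := indep e fun50 vec50 tri50 diag50 c fun i => hk i hz
      simp [this]
    have hUfin : Module.Finite K (Submodule.span K (Set.range v)) :=
      Submodule.finiteDimensional_of_le hUE
    have hsum := Submodule.finrank_sup_add_finrank_inf_eq W (Submodule.span K (Set.range v))
    rw [hdis, finrank_bot, finrank_span_eq_card hv, Fintype.card_fin] at hsum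
    have := Submodule.finrank_mono (sup_le hWE hUE)
    omega
  · let v : Fin 20 → ExteriorAlgebra K V := fun j => ιMulti K 4 fun k => vv e (vec20 j k)
    have hv : LinearIndependent K v := linInd e fun20 vec20 tri20 diag20
    have hUW : Submodule.span K (Set.range v) ≤ W := by
      refine Submodule.span_le.2 ?_
      rintro _ ⟨i, rfl⟩
      obtain ⟨ha, hb, hc, hd⟩ := idx20 i
      have m1 : ∀ a : Fin 8, a < 4 → e a ∈ H₁ := fun a ha => by
        rw [g1]
        exact Submodule.subset_span ⟨⟨a, ha⟩, vv_sg e a⟩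
      have m2 : ∀ a : Fin 8, a < 4 → e (a + 4) ∈ H₂ := fun a ha => by
        rw [g2]
        exact Submodule.subset_span ⟨⟨a, ha⟩, vv_sg e (a + 4)⟩
      have m3 : ∀ a : Fin 8, a < 4 → e a + e (a + 4) ∈ H₃ := fun a ha => by
        rw [g3]
        exact Submodule.subset_span ⟨⟨a, ha⟩, by
          rw [← vv_sg e a, ← vv_sg e (a + 4), ← vv_add]; rfl⟩
      have key : ∀ a b c d : Fin 8, a < 4 → b < 4 → c < 4 → d < 4 →
          ιMulti K 4 ![e a + e b, e c + e d, e (a + 4) + e (b + 4), e (c + 4) + e (d + 4)] ∈ W := by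
        intro a b c d ha hb hc hd
        refine mem_all H₁ H₂ H₃ _ _ _ _ (add_mem (m1 a ha) (m1 b hb)) (add_mem (m1 c hc) (m1 d hd))
          (add_mem (m2 a ha) (m2 b hb)) (add_mem (m2 c hc) (m2 d hd)) ?_ ?_
        · rw [add_add_add_comm]; exact add_mem (m3 a ha) (m3 b hb)
        · rw [add_add_add_comm]; exact add_mem (m3 c hc) (m3 d hd)
      have := key _ _ _ _ ha hb hc hd
      simp only [← vv_s2] at this
      change ιMulti K 4 _ ∈ W
      convert this using 2
      ext k
      fin_cases k <;> rfl
    have := Submodule.finrank_mono hUW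
    rwa [finrank_span_eq_card hv, Fintype.card_fin] at this
end

section
/- Let V be a 9-dimensional vector space over a field K of characteristic zero with basis e_1, …, e_9, and set H_1 = span{e_1, e_2, e_3}, H_2 = span{e_4, e_5, e_6}, H_3 = span{e_7, e_8, e_9}, H_4 = span{e_1 + e_4 + e_7, e_2 + e_5 + e_8, e_3 + e_6 + e_9}. Then the intersection W = Q_6(H_1) ∩ Q_6(H_2) ∩ Q_6(H_3) ∩ Q_6(H_4) inside ⋀^6 V has dimension exactly 10. -/
open ExteriorAlgebra

/-- position of the `i`-th vector of block `b`. -/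
def blk (b i : Fin 3) : Fin 9 := ⟨3 * b.val + i.val, by omega⟩

/-- Laplace expansion, computable. -/
def detC : (n : ℕ) → (Fin n → Fin n → ℤ) → ℤ
  | 0, _ => 1
  | n + 1, A => ∑ j : Fin (n + 1), if A 0 j = 0 then 0 else
      (-1) ^ (j : ℕ) * A 0 j * detC n (fun a b => A a.succ (j.succAbove b))

theorem detC_eq (n : ℕ) (A : Fin n → Fin n → ℤ) : detC n A = Matrix.det (Matrix.of A) := by
  induction n with
  | zero => simp [detC]
  | succ n ih =>
    rw [Matrix.det_succ_row_zero, detC]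
    refine Finset.sum_congr rfl fun j _ => ?_
    split_ifs with h
    · simp [h]
    · rw [ih]; rfl

/-- the six indices of the monomial `G 0 i * G 1 j * G 2 k`. -/
def sx (i j k : Fin 3) : Fin 6 → Fin 9 :=
  ![blk 0 (i + 1), blk 0 (i + 2), blk 1 (j + 1), blk 1 (j + 2), blk 2 (k + 1), blk 2 (k + 2)]

def tblI : Fin 18 → Fin 6 → Fin 3 :=
  ![![2, 2, 2, 1, 1, 0],
    ![2, 2, 2, 1, 1, 0],
    ![1, 1, 1, 2, 2, 0],
    ![1, 1, 1, 2, 2, 0],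
    ![2, 2, 2, 0, 0, 1],
    ![2, 2, 2, 0, 0, 1],
    ![0, 0, 0, 2, 2, 1],
    ![0, 0, 0, 2, 2, 1],
    ![1, 1, 1, 0, 0, 2],
    ![1, 1, 1, 0, 0, 2],
    ![0, 0, 0, 1, 1, 2],
    ![0, 0, 0, 1, 1, 2],
    ![0, 0, 1, 1, 2, 2],
    ![0, 0, 1, 1, 2, 2],
    ![1, 1, 0, 0, 2, 2],
    ![1, 1, 0, 0, 2, 2],
    ![2, 2, 0, 0, 1, 1],
    ![2, 2, 0, 0, 1, 1]]

def tblA : Fin 18 → Fin 6 → Fin 3 :=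
  ![![0, 1, 2, 1, 2, 1],
    ![0, 1, 2, 1, 2, 2],
    ![0, 1, 2, 1, 2, 1],
    ![0, 1, 2, 1, 2, 2],
    ![0, 1, 2, 1, 2, 1],
    ![0, 1, 2, 1, 2, 2],
    ![0, 1, 2, 1, 2, 1],
    ![0, 1, 2, 1, 2, 2],
    ![0, 1, 2, 1, 2, 1],
    ![0, 1, 2, 1, 2, 2],
    ![0, 1, 2, 1, 2, 1],
    ![0, 1, 2, 1, 2, 2],
    ![0, 1, 1, 2, 1, 2],
    ![0, 2, 1, 2, 1, 2],
    ![0, 1, 1, 2, 1, 2],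
    ![0, 2, 1, 2, 1, 2],
    ![0, 1, 1, 2, 1, 2],
    ![0, 2, 1, 2, 1, 2]]

def tblP : Fin 18 → (Fin 3 × Fin 3 × Fin 3) × (Fin 3 × Fin 3 × Fin 3) :=
  ![((0, 0, 1), (1, 0, 0)),
    ((0, 0, 1), (0, 1, 0)),
    ((2, 0, 0), (0, 0, 2)),
    ((0, 2, 0), (0, 0, 2)),
    ((0, 1, 1), (1, 1, 0)),
    ((1, 0, 1), (1, 1, 0)),
    ((1, 1, 2), (2, 1, 1)),
    ((1, 1, 2), (1, 2, 1)),
    ((2, 2, 0), (0, 2, 2)),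
    ((2, 2, 0), (2, 0, 2)),
    ((1, 2, 2), (2, 2, 1)),
    ((2, 1, 2), (2, 2, 1)),
    ((1, 0, 2), (2, 0, 1)),
    ((0, 1, 2), (0, 2, 1)),
    ((2, 1, 0), (0, 1, 2)),
    ((1, 2, 0), (1, 0, 2)),
    ((0, 2, 1), (1, 2, 0)),
    ((2, 0, 1), (2, 1, 0))]

/-- the three rows used: `0` is arbitrary, `1` and `2` kill the diagonal. -/
def alpha : Fin 3 → Fin 3 → ℤ := ![![0, 0, 1], ![1, 0, -1], ![0, 1, -1]]

/-- integer 6 x 9 matrices of functionals -/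
def Phi (n : Fin 18) (j : Fin 6) (k : Fin 9) : ℤ :=
  if k.val % 3 = (tblI n j).val then alpha (tblA n j) ⟨k.val / 3, by omega⟩ else 0

theorem Phi_det : ∀ n : Fin 18, ∀ i j k : Fin 3,
    detC 6 (fun a b => Phi n b (sx i j k a)) =
      (if (tblP n).1 = (i, j, k) then 1 else 0) - (if (tblP n).2 = (i, j, k) then 1 else 0) := by
  decide +kernel

theorem coord_det : ∀ i j k i' j' k' : Fin 3,
    detC 6 (fun a b => if sx i j k b = sx i' j' k' a then 1 else 0) =
      (if (i, j, k) = (i', j', k') then 1 else 0) := by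
  decide +kernel

theorem Phi_diag : ∀ n : Fin 18, ∀ j : Fin 6, j ≠ 0 → ∀ i : Fin 3,
    Phi n j (blk 0 i) + Phi n j (blk 1 i) + Phi n j (blk 2 i) = 0 := by
  decide +kernel

/-- strictly increasing version of `sx` -/
def srt (i j k : Fin 3) : Fin 6 → Fin 9 :=
  let lo : Fin 3 → Fin 3 := ![1, 0, 0]
  let hi : Fin 3 → Fin 3 := ![2, 2, 1]
  ![blk 0 (lo i), blk 0 (hi i), blk 1 (lo j), blk 1 (hi j), blk 2 (lo k), blk 2 (hi k)]

theorem srt_mono : ∀ i j k : Fin 3, ∀ a b : Fin 6, srt i j k a ≤ srt i j k b ↔ a ≤ b := by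
  decide +kernel

theorem pair_block : ∀ b : Fin 3, ∀ x y : Fin 9, x.val / 3 = b.val → y.val / 3 = b.val → x ≠ y →
    ∃ i : Fin 3, (x = blk b ((![1, 0, 0] : Fin 3 → Fin 3) i) ∧
        y = blk b ((![2, 2, 1] : Fin 3 → Fin 3) i)) ∨
      (y = blk b ((![1, 0, 0] : Fin 3 → Fin 3) i) ∧
        x = blk b ((![2, 2, 1] : Fin 3 → Fin 3) i)) := by
  decide +kernel

theorem good_block (S : Finset (Fin 9)) (b : Fin 3)
    (h : 2 ≤ (S.filter (fun x => x.val / 3 == b.val)).card) :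
    ∃ i : Fin 3, blk b ((![1, 0, 0] : Fin 3 → Fin 3) i) ∈ S ∧
      blk b ((![2, 2, 1] : Fin 3 → Fin 3) i) ∈ S := by
  obtain ⟨x, hx, y, hy, hxy⟩ := Finset.one_lt_card.1 h
  simp only [Finset.mem_filter, beq_iff_eq] at hx hy
  obtain ⟨i, ⟨h1, h2⟩ | ⟨h1, h2⟩⟩ := pair_block b x y hx.2 hy.2 hxy
  · exact ⟨i, h1 ▸ hx.1, h2 ▸ hy.1⟩
  · exact ⟨i, h1 ▸ hy.1, h2 ▸ hx.1⟩

theorem good_finset (S : Finset (Fin 9)) (hS : S.card = 6)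
    (h : ∀ b : Fin 3, 2 ≤ (S.filter (fun x => x.val / 3 == b.val)).card) :
    ∃ i j k, Finset.univ.image (srt i j k) = S := by
  obtain ⟨i, hi, hi'⟩ := good_block S 0 (h 0)
  obtain ⟨j, hj, hj'⟩ := good_block S 1 (h 1)
  obtain ⟨k, hk, hk'⟩ := good_block S 2 (h 2)
  refine ⟨i, j, k, Finset.eq_of_subset_of_card_le ?_ ?_⟩
  · intro x hx
    obtain ⟨a, -, rfl⟩ := Finset.mem_image.1 hx
    fin_cases a
    exacts [hi, hi', hj, hj', hk, hk']
  · have inj : Function.Injective (srt i j k) := fun a b hab =>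
      le_antisymm ((srt_mono i j k a b).1 hab.le) ((srt_mono i j k b a).1 hab.ge)
    rw [Finset.card_image_of_injective _ inj, hS]
    simp

/-- orbit index -/
def idx (p : Fin 3 × Fin 3 × Fin 3) : Fin 10 :=
  (![![![0, 3, 4], ![3, 5, 9], ![4, 9, 7]],
     ![![3, 5, 9], ![5, 1, 6], ![9, 6, 8]],
     ![![4, 9, 7], ![9, 6, 8], ![7, 8, 2]]] : Fin 3 → Fin 3 → Fin 3 → Fin 10) p.1 p.2.1 p.2.2

/-- orbit representative -/
def rep : Fin 10 → Fin 3 × Fin 3 × Fin 3 :=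
  ![(0, 0, 0), (1, 1, 1), (2, 2, 2), (0, 0, 1), (0, 0, 2), (0, 1, 1), (1, 1, 2), (0, 2, 2),
    (1, 2, 2), (0, 1, 2)]

theorem idx_rep : ∀ n, idx (rep n) = n := by decide +kernel

theorem sym_of_rel {K : Type*} (c : Fin 3 × Fin 3 × Fin 3 → K)
    (h : ∀ n, c (tblP n).1 = c (tblP n).2) (p) : c (rep (idx p)) = c p := by
  have h0 := h 0
  have h1 := h 1
  have h2 := h 2
  have h3 := h 3
  have h4 := h 4
  have h5 := h 5
  have h6 := h 6
  have h7 := h 7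
  have h8 := h 8
  have h9 := h 9
  have h10 := h 10
  have h11 := h 11
  have h12 := h 12
  have h13 := h 13
  have h14 := h 14
  have h15 := h 15
  have h16 := h 16
  have h17 := h 17
  clear h
  simp only [tblP, Matrix.cons_val] at *
  obtain ⟨i, j, k⟩ := p
  fin_cases i <;> fin_cases j <;> fin_cases k <;> simp [idx, rep] <;> grind

section
variable {K V : Type*} [Field K] [AddCommGroup V] [Module K V]

/-- determinant functional attached to six linear forms -/
noncomputable def Fn (φ : Fin 6 → Module.Dual K V) : ExteriorAlgebra K V →ₗ[K] K :=
  (liftAlternating (R := K) (Pi.single 6 (Matrix.detRowAlternating (n := Fin 6) (R := K)))).comp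
    (ExteriorAlgebra.map (LinearMap.pi φ)).toLinearMap

theorem Fn_ιMulti (φ : Fin 6 → Module.Dual K V) (v : Fin 6 → V) :
    Fn φ (ιMulti K 6 v) = Matrix.det (Matrix.of fun i j => φ j (v i)) := by
  simp only [Fn, LinearMap.comp_apply, AlgHom.toLinearMap_apply, map_apply_ιMulti,
    liftAlternating_apply_ιMulti, Pi.single_eq_same]
  change Matrix.det _ = _
  congr 1

theorem Fn_Q (φ : Fin 6 → Module.Dual K V) (H : Submodule K V) (j0 : Fin 6)
    (h : ∀ x ∈ H, ∀ j, j ≠ j0 → φ j x = 0) (w) (hw : w ∈ Q K 6 H) : Fn φ w = 0 := by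
  have key : ∀ x ∈ H, LinearMap.pi φ x = φ j0 x • (Pi.single j0 1 : Fin 6 → K) := by
    intro x hx
    ext j
    by_cases hj : j = j0
    · subst hj; simp
    · simp [hj, h x hx j hj]
  have : Q K 6 H ≤ LinearMap.ker (Fn φ) := by
    refine Submodule.span_le.2 ?_
    rintro z ⟨x, hx, y, hy, m, -, rfl⟩
    simp [Fn, key x hx, key y hy]
  exact this hw

theorem Q_le (H : Submodule K V) : Q K 6 H ≤ ⋀[K]^6 V := by
  refine Submodule.span_le.2 ?_
  rintro z ⟨x, hx, y, hy, m, hm, rfl⟩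
  have h2 : ι K x * ι K y ∈ ⋀[K]^2 V := by
    have := (ιMulti_range K 2 (M := V)) ⟨![x, y], rfl⟩
    simpa [ιMulti_apply] using this
  exact SetLike.mul_mem_graded (A := fun n => ⋀[K]^n V) h2 hm

/-- bivectors -/
noncomputable def G (K : Type*) {V : Type*} [Field K] [AddCommGroup V] [Module K V]
    (e : Fin 9 → V) (b i : Fin 3) : ExteriorAlgebra K V :=
  ι K (e (blk b (i + 1))) * ι K (e (blk b (i + 2)))

/-- triple products -/
noncomputable def X (K : Type*) {V : Type*} [Field K] [AddCommGroup V] [Module K V]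
    (e : Fin 9 → V) (p : Fin 3 × Fin 3 × Fin 3) : ExteriorAlgebra K V :=
  G K e 0 p.1 * G K e 1 p.2.1 * G K e 2 p.2.2

/-- orbit sums -/
noncomputable def Bs (K : Type*) {V : Type*} [Field K] [AddCommGroup V] [Module K V]
    (e : Fin 9 → V) (n : Fin 10) : ExteriorAlgebra K V :=
  ∑ p, if idx p = n then X K e p else 0

theorem sum_Bs (e : Fin 9 → V) (g : Fin 10 → K) :
    ∑ n, g n • Bs K e n = ∑ p, g (idx p) • X K e p := by
  simp only [Bs, Finset.smul_sum, smul_ite, smul_zero]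
  rw [Finset.sum_comm]
  simp

theorem X_eq (e : Fin 9 → V) (i j k : Fin 3) :
    X K e (i, j, k) = ιMulti K 6 (e ∘ sx i j k) := by
  simp only [X, G, ιMulti_apply, sx, List.ofFn_succ, List.ofFn_zero, List.prod_cons, List.prod_nil,
    mul_one, mul_assoc]
  rfl

theorem ι_swap (x y : V) : ι K x * ι K y = -(ι K y * ι K x) :=
  eq_neg_of_add_eq_zero_left (ι_add_mul_swap x y)

theorem bi_comm (a b c d : V) : (ι K a * ι K b) * (ι K c * ι K d) =
    (ι K c * ι K d) * (ι K a * ι K b) := by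
  have h1 : ι K b * (ι K c * ι K d) = ι K c * ι K d * ι K b := by
    rw [← mul_assoc, ι_swap b c, neg_mul, mul_assoc, ι_swap b d, mul_neg, neg_neg, mul_assoc]
  have h2 : ι K a * (ι K c * ι K d) = ι K c * ι K d * ι K a := by
    rw [← mul_assoc, ι_swap a c, neg_mul, mul_assoc, ι_swap a d, mul_neg, neg_neg, mul_assoc]
  rw [mul_assoc, h1, ← mul_assoc, h2, mul_assoc]

theorem mem4 (a b c d : V) : (ι K a * ι K b) * (ι K c * ι K d) ∈ ⋀[K]^4 V := by
  have := (ιMulti_range K 4 (M := V)) ⟨![a, b, c, d], rfl⟩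
  simpa [ιMulti_apply, List.ofFn_succ, mul_assoc] using this

/-- the copy of `u` in block `b` -/
def cp (e : Fin 9 → V) (b : Fin 3) (u : Fin 3 → K) : V := ∑ i, u i • e (blk b i)

theorem cp_bi (e : Fin 9 → V) (b : Fin 3) (u v : Fin 3 → K) :
    ι K (cp e b u) * ι K (cp e b v) = (u 1 * v 2 - u 2 * v 1) • G K e b 0 +
      (u 2 * v 0 - u 0 * v 2) • G K e b 1 + (u 0 * v 1 - u 1 * v 0) • G K e b 2 := by
  simp only [cp, G, Fin.sum_univ_three, map_add, map_smul, mul_add, add_mul,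
    smul_mul_smul_comm, ι_sq_zero]
  have e1 : (1 : Fin 3) + 1 = 2 := rfl
  have e2 : (1 : Fin 3) + 2 = 0 := rfl
  have e3 : (2 : Fin 3) + 1 = 0 := rfl
  have e4 : (2 : Fin 3) + 2 = 1 := rfl
  simp only [zero_add, e1, e2, e3, e4]
  rw [ι_swap (e (blk b 1)) (e (blk b 0)), ι_swap (e (blk b 2)) (e (blk b 1)),
    ι_swap (e (blk b 0)) (e (blk b 2))]
  module

/-- the cube of `a` -/
noncomputable def Pv (K : Type*) {V : Type*} [Field K] [AddCommGroup V] [Module K V]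
    (e : Fin 9 → V) (a : Fin 3 → K) : ExteriorAlgebra K V :=
  ∑ p : Fin 3 × Fin 3 × Fin 3, (a p.1 * a p.2.1 * a p.2.2) • X K e p

theorem Pv_eq (e : Fin 9 → V) (a : Fin 3 → K) :
    Pv K e a = (∑ i, a i • G K e 0 i) * (∑ i, a i • G K e 1 i) * (∑ i, a i • G K e 2 i) := by
  simp only [Pv, X, Fintype.sum_prod_type, Fin.sum_univ_three, mul_add, add_mul,
    smul_mul_smul_comm]
  abel

theorem cube_mem (e : Fin 9 → V) (H : Fin 4 → Submodule K V)
    (h : ∀ b : Fin 3, ∀ u : Fin 3 → K, cp e b u ∈ H b.castSucc)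
    (h4 : ∀ u : Fin 3 → K, cp e 0 u + cp e 1 u + cp e 2 u ∈ H 3) (u v : Fin 3 → K) (n : Fin 4) :
    Pv K e ![u 1 * v 2 - u 2 * v 1, u 2 * v 0 - u 0 * v 2, u 0 * v 1 - u 1 * v 0] ∈
      Q K 6 (H n) := by
  have hP : Pv K e ![u 1 * v 2 - u 2 * v 1, u 2 * v 0 - u 0 * v 2, u 0 * v 1 - u 1 * v 0] =
      (ι K (cp e 0 u) * ι K (cp e 0 v)) * (ι K (cp e 1 u) * ι K (cp e 1 v)) *
        (ι K (cp e 2 u) * ι K (cp e 2 v)) := by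
    rw [Pv_eq, cp_bi, cp_bi, cp_bi]
    simp [Fin.sum_univ_three]
  rw [hP]
  fin_cases n
  · exact Submodule.subset_span ⟨_, h 0 u, _, h 0 v, _, mem4 _ _ _ _, by rw [mul_assoc]⟩
  · refine Submodule.subset_span ⟨_, h 1 u, _, h 1 v, _,
      mem4 (cp e 0 u) (cp e 0 v) (cp e 2 u) (cp e 2 v), ?_⟩
    rw [bi_comm (cp e 0 u), mul_assoc]
  · refine Submodule.subset_span ⟨_, h 2 u, _, h 2 v, _,
      mem4 (cp e 0 u) (cp e 0 v) (cp e 1 u) (cp e 1 v), ?_⟩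
    rw [mul_assoc, bi_comm (cp e 1 u), ← mul_assoc, bi_comm (cp e 0 u), mul_assoc]
  · refine Submodule.subset_span ⟨_, h4 u, _, h4 v, _,
      mem4 (cp e 1 u) (cp e 1 v) (cp e 2 u) (cp e 2 v), ?_⟩
    generalize cp e 0 u = a0
    generalize cp e 1 u = a1
    generalize cp e 2 u = a2
    generalize cp e 0 v = b0
    generalize cp e 1 v = b1
    generalize cp e 2 v = b2
    have t1 : ∀ a b : V, ι K b * (ι K a * ι K b) = 0 := by
      intro a b; rw [ι_swap a b, mul_neg, ← mul_assoc, ι_sq_zero, zero_mul, neg_zero]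
    have t2 : ∀ a b : V, ι K a * (ι K a * ι K b) = 0 := by
      intro a b; rw [← mul_assoc, ι_sq_zero, zero_mul]
    have z1 : ι K b1 * ((ι K a1 * ι K b1) * (ι K a2 * ι K b2)) = 0 := by
      rw [← mul_assoc, t1, zero_mul]
    have z2 : ι K b2 * ((ι K a1 * ι K b1) * (ι K a2 * ι K b2)) = 0 := by
      rw [bi_comm, ← mul_assoc, t1, zero_mul]
    have z3 : ι K a1 * ((ι K a1 * ι K b1) * (ι K a2 * ι K b2)) = 0 := by
      rw [← mul_assoc, t2, zero_mul]
    have z4 : ι K a2 * ((ι K a1 * ι K b1) * (ι K a2 * ι K b2)) = 0 := by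
      rw [bi_comm, ← mul_assoc, t2, zero_mul]
    rw [mul_assoc (ι K a0 * ι K b0)]
    generalize (ι K a1 * ι K b1) * (ι K a2 * ι K b2) = m at z1 z2 z3 z4 ⊢
    have w1 : ι K (b0 + b1 + b2) * m = ι K b0 * m := by
      rw [map_add, map_add, add_mul, add_mul, z1, z2, add_zero, add_zero]
    have w2 : ∀ a : V, ι K a * m = 0 → ι K a * (ι K b0 * m) = 0 := by
      intro a ha
      rw [← mul_assoc, ι_swap a b0, neg_mul, mul_assoc, ha, mul_zero, neg_zero]
    rw [mul_assoc _ _ m, mul_assoc (ι K (a0 + a1 + a2)), w1, map_add, map_add, add_mul, add_mul, w2 _ z3, w2 _ z4, add_zero,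
      add_zero]

/-- six linear forms from an integer matrix -/
noncomputable def phi (e : Module.Basis (Fin 9) K V) (Φ : Fin 6 → Fin 9 → ℤ) (j : Fin 6) :
    Module.Dual K V := ∑ k, (Φ j k : K) • e.coord k

theorem phi_e (e : Module.Basis (Fin 9) K V) (Φ : Fin 6 → Fin 9 → ℤ) (j : Fin 6) (k : Fin 9) :
    phi e Φ j (e k) = Φ j k := by
  simp [phi, Finsupp.single_apply]

theorem Fn_X (e : Module.Basis (Fin 9) K V) (Φ : Fin 6 → Fin 9 → ℤ) (i j k : Fin 3) :
    Fn (phi e Φ) (X K e (i, j, k)) = ((detC 6 (fun a b => Φ b (sx i j k a)) : ℤ) : K) := by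
  rw [X_eq, Fn_ιMulti, detC_eq, Int.cast_det]
  congr 1
  ext a b
  simp [phi_e]

theorem Fn_sum (e : Module.Basis (Fin 9) K V) (c : Fin 3 × Fin 3 × Fin 3 → K) (n : Fin 18) :
    Fn (phi e (Phi n)) (∑ p, c p • X K e p) = c (tblP n).1 - c (tblP n).2 := by
  have : ∀ p, Fn (phi e (Phi n)) (X K e p) =
      (if (tblP n).1 = p then 1 else 0) - (if (tblP n).2 = p then 1 else 0) := by
    rintro ⟨i, j, k⟩
    rw [Fn_X, Phi_det]
    push_cast
    rfl
  simp [this, mul_sub, Finset.sum_sub_distrib]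

theorem Fn_coord (e : Module.Basis (Fin 9) K V) (c : Fin 3 × Fin 3 × Fin 3 → K)
    (q : Fin 3 × Fin 3 × Fin 3) :
    Fn (phi e (fun b m => if sx q.1 q.2.1 q.2.2 b = m then 1 else 0))
      (∑ p, c p • X K e p) = c q := by
  have : ∀ p, Fn (phi e (fun b m => if sx q.1 q.2.1 q.2.2 b = m then 1 else 0)) (X K e p) =
      (if q = p then 1 else 0) := by
    rintro ⟨i, j, k⟩
    rw [Fn_X, coord_det]
    push_cast
    rfl
  simp [this]

theorem Bs_li (e : Module.Basis (Fin 9) K V) : LinearIndependent K (Bs K e) := by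
  rw [Fintype.linearIndependent_iff]
  intro g hg n
  rw [sum_Bs] at hg
  have := Fn_coord e (fun p => g (idx p)) (rep n)
  rw [hg, map_zero, idx_rep] at this
  exact this.symm

theorem coord_zero (e : Module.Basis (Fin 9) K V) (b : ℕ) (H : Submodule K V)
    (hH : ∀ x ∈ H, ∀ k : Fin 9, k.val / 3 ≠ b → e.coord k x = 0)
    (S : Set.powersetCard (Fin 9) 6)
    (hS : ¬ 2 ≤ ((S : Finset (Fin 9)).filter (fun x => x.val / 3 == b)).card)
    (w : ⋀[K]^6 V) (hw : (w : ExteriorAlgebra K V) ∈ Q K 6 H) :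
    (e.exteriorPower 6).repr w S = 0 := by
  rw [exteriorPower.basis_repr_apply]
  set f := Set.powersetCard.ofFinEmbEquiv.symm S with hf
  have h1 : exteriorPower.ιMultiDual K 6 e S =
      (Fn (fun j => e.coord (f j))).comp (Submodule.subtype _) := by
    apply exteriorPower.linearMap_ext
    ext v
    change exteriorPower.ιMultiDual K 6 e S (exteriorPower.ιMulti K 6 v) =
      Fn (fun j => e.coord (f j)) (ιMulti K 6 v)
    rw [exteriorPower.ιMultiDual_apply_ιMulti, Fn_ιMulti]
  rw [h1]
  have hmem : ∀ j, f j ∈ (S : Finset (Fin 9)) := fun j =>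
    (Set.powersetCard.mem_range_ofFinEmbEquiv_symm_iff_mem S (f j)).1 ⟨j, rfl⟩
  have : ∃ j0, ∀ j, j ≠ j0 → (f j).val / 3 ≠ b := by
    by_contra! hcon
    obtain ⟨j1, -, h1⟩ := hcon 0
    obtain ⟨j2, h12, h2⟩ := hcon j1
    apply hS
    have : ({f j1, f j2} : Finset (Fin 9)) ⊆
        (S : Finset (Fin 9)).filter (fun x => x.val / 3 == b) := by
      intro x hx
      simp only [Finset.mem_insert, Finset.mem_singleton] at hx
      rcases hx with rfl | rfl <;> simp [hmem, h1, h2]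
    have h3 := Finset.card_le_card this
    rwa [Finset.card_pair (fun h => h12 (f.injective h).symm)] at h3
  obtain ⟨j0, hj0⟩ := this
  exact Fn_Q _ H j0 (fun x hx j hj => hH x hx _ (hj0 j hj)) _ hw

theorem bi_span (e : Fin 9 → V) (b : Fin 3) (i : Fin 3) :
    ∃ (ε : K), ι K (e (blk b ((![1, 0, 0] : Fin 3 → Fin 3) i))) *
      ι K (e (blk b ((![2, 2, 1] : Fin 3 → Fin 3) i))) = ε • G K e b i := by
  fin_cases i
  · exact ⟨1, by simp [G]⟩
  · refine ⟨-1, ?_⟩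
    rw [neg_one_smul]
    exact ι_swap _ _
  · refine ⟨1, ?_⟩
    rw [one_smul]
    rfl

theorem srt_mem (e : Fin 9 → V) (i j k : Fin 3) :
    ιMulti K 6 (e ∘ srt i j k) ∈ Submodule.span K (Set.range (X K e)) := by
  obtain ⟨a, ha⟩ := bi_span (K := K) e 0 i
  obtain ⟨b, hb⟩ := bi_span (K := K) e 1 j
  obtain ⟨c, hc⟩ := bi_span (K := K) e 2 k
  have : ιMulti K 6 (e ∘ srt i j k) = (a * b * c) • X K e (i, j, k) := by
    simp only [X, ← smul_mul_smul_comm, ← ha, ← hb, ← hc]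
    simp only [ιMulti_apply, srt, List.ofFn_succ, List.ofFn_zero, List.prod_cons, List.prod_nil,
      mul_one, mul_assoc]
    rfl
  rw [this]
  exact Submodule.smul_mem _ _ (Submodule.subset_span ⟨_, rfl⟩)

theorem mem_span_X (e : Module.Basis (Fin 9) K V) (H : Fin 3 → Submodule K V)
    (hH : ∀ b : Fin 3, ∀ x ∈ H b, ∀ k : Fin 9, k.val / 3 ≠ b.val → e.coord k x = 0)
    (w : ExteriorAlgebra K V) (hw : ∀ b, w ∈ Q K 6 (H b)) :
    w ∈ Submodule.span K (Set.range (X K e)) := by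
  have hw6 : w ∈ ⋀[K]^6 V := Q_le _ (hw 0)
  have hs := congrArg (Submodule.subtype _) ((e.exteriorPower 6).sum_repr ⟨w, hw6⟩)
  simp only [map_sum, map_smul, Submodule.subtype_apply] at hs
  rw [← hs]
  refine Submodule.sum_mem _ fun S _ => ?_
  by_cases h : ∀ b : Fin 3, 2 ≤ ((S : Finset (Fin 9)).filter (fun x => x.val / 3 == b.val)).card
  · refine Submodule.smul_mem _ _ ?_
    obtain ⟨i, j, k, hijk⟩ := good_finset S.1 S.2 h
    let f : Fin 6 ↪o Fin 9 := OrderEmbedding.ofMapLEIff (srt i j k) (srt_mono i j k)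
    have hSf : S = Set.powersetCard.ofFinEmbEquiv f := by
      apply Subtype.ext
      rw [← hijk]
      ext x
      have := Set.powersetCard.mem_ofFinEmbEquiv_iff_mem_range f x
      rw [show (x ∈ (Set.powersetCard.ofFinEmbEquiv f).1 ↔ x ∈ Set.range f) from this]
      simp [f]
    rw [exteriorPower.basis_apply, exteriorPower.ιMulti_family_apply_coe, hSf]
    rw [ExteriorAlgebra.ιMulti_family, Equiv.symm_apply_apply]
    exact srt_mem e i j k
  · push Not at h
    obtain ⟨b, hb⟩ := h
    rw [coord_zero e b.val (H b) (hH b) S (by simpa using hb) ⟨w, hw6⟩ (hw b), zero_smul]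
    exact Submodule.zero_mem _

theorem Bs_mem [CharZero K] (e : Fin 9 → V) (W : Submodule K (ExteriorAlgebra K V))
    (h : ∀ u v : Fin 3 → K,
      Pv K e ![u 1 * v 2 - u 2 * v 1, u 2 * v 0 - u 0 * v 2, u 0 * v 1 - u 1 * v 0] ∈ W)
    (n : Fin 10) : Bs K e n ∈ W := by
  have g1 : ∀ s t : K, Pv K e ![1, s, t] ∈ W := fun s t => by
    simpa using h ![-s, 1, 0] ![-t, 0, 1]
  have g2 : ∀ t : K, Pv K e ![0, 1, t] ∈ W := fun t => by
    simpa using h ![1, 0, 0] ![0, t, -1]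
  have g3 : Pv K e ![0, 0, 1] ∈ W := by
    simpa using h ![1, 0, 0] ![0, 1, 0]
  have dif : ∀ x y z : ExteriorAlgebra K V, x ∈ W → y ∈ W → z ∈ W →
      (1 / 2 : K) • (x - y) - z ∈ W := fun x y z hx hy hz =>
    W.sub_mem (W.smul_mem _ (W.sub_mem hx hy)) hz
  have sm : ∀ x y z : ExteriorAlgebra K V, x ∈ W → y ∈ W → z ∈ W →
      (1 / 2 : K) • (x + y) - z ∈ W := fun x y z hx hy hz =>
    W.sub_mem (W.smul_mem _ (W.add_mem hx hy)) hz
  have l := W.add_mem (W.add_mem (W.add_mem (W.sub_mem (W.sub_mem (W.sub_mem (g1 1 1) (g1 1 0))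
    (g1 0 1)) (g2 1)) (g1 0 0)) (g2 0)) g3
  fin_cases n
  · convert g1 0 0 using 1
    simp [Bs, Pv, Fintype.sum_prod_type, Fin.sum_univ_three, idx]
  · convert g2 0 using 1
    simp [Bs, Pv, Fintype.sum_prod_type, Fin.sum_univ_three, idx]
  · convert g3 using 1
    simp [Bs, Pv, Fintype.sum_prod_type, Fin.sum_univ_three, idx]
  · convert dif _ _ _ (g1 1 0) (g1 (-1) 0) (g2 0) using 1
    simp [Bs, Pv, Fintype.sum_prod_type, Fin.sum_univ_three, idx]
    module
  · convert dif _ _ _ (g1 0 1) (g1 0 (-1)) g3 using 1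
    simp [Bs, Pv, Fintype.sum_prod_type, Fin.sum_univ_three, idx]
    module
  · convert sm _ _ _ (g1 1 0) (g1 (-1) 0) (g1 0 0) using 1
    simp [Bs, Pv, Fintype.sum_prod_type, Fin.sum_univ_three, idx]
    module
  · convert dif _ _ _ (g2 1) (g2 (-1)) g3 using 1
    simp [Bs, Pv, Fintype.sum_prod_type, Fin.sum_univ_three, idx]
    module
  · convert sm _ _ _ (g1 0 1) (g1 0 (-1)) (g1 0 0) using 1
    simp [Bs, Pv, Fintype.sum_prod_type, Fin.sum_univ_three, idx]
    module
  · convert sm _ _ _ (g2 1) (g2 (-1)) (g2 0) using 1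
    simp [Bs, Pv, Fintype.sum_prod_type, Fin.sum_univ_three, idx]
    module
  · convert l using 1
    simp [Bs, Pv, Fintype.sum_prod_type, Fin.sum_univ_three, idx]
    module

end


/-- For a 9-dimensional space `V` with basis `e₁, …, e₉` (indexed here by `Fin 9`) and
the subspaces `H₁ = span{e₁,e₂,e₃}`, `H₂ = span{e₄,e₅,e₆}`, `H₃ = span{e₇,e₈,e₉}`,
`H₄ = span{e₁+e₄+e₇, e₂+e₅+e₈, e₃+e₆+e₉}`, the intersection
`Q₆(H₁) ∩ Q₆(H₂) ∩ Q₆(H₃) ∩ Q₆(H₄)` inside `⋀^6 V` has dimension exactly 10. -/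
theorem stmt14 {K V : Type*} [Field K] [CharZero K] [AddCommGroup V] [Module K V]
    (e : Module.Basis (Fin 9) K V)
    (H₁ H₂ H₃ H₄ : Submodule K V)
    (hH₁ : H₁ = Submodule.span K {e 0, e 1, e 2})
    (hH₂ : H₂ = Submodule.span K {e 3, e 4, e 5})
    (hH₃ : H₃ = Submodule.span K {e 6, e 7, e 8})
    (hH₄ : H₄ = Submodule.span K {e 0 + e 3 + e 6, e 1 + e 4 + e 7, e 2 + e 5 + e 8}) :
    Module.finrank K ↥(Q K 6 H₁ ⊓ Q K 6 H₂ ⊓ Q K 6 H₃ ⊓ Q K 6 H₄) = 10 := by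
  subst hH₁ hH₂ hH₃ hH₄
  set H : Fin 4 → Submodule K V := ![Submodule.span K {e 0, e 1, e 2},
    Submodule.span K {e 3, e 4, e 5}, Submodule.span K {e 6, e 7, e 8},
    Submodule.span K {e 0 + e 3 + e 6, e 1 + e 4 + e 7, e 2 + e 5 + e 8}] with hH
  have hcp : ∀ b : Fin 3, ∀ u : Fin 3 → K, cp e b u ∈ H b.castSucc := by
    intro b u
    refine Submodule.sum_mem _ fun i _ => Submodule.smul_mem _ _ ?_
    fin_cases b <;> fin_cases i <;>
      exact Submodule.subset_span (by simp [blk])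
  have hcp4 : ∀ u : Fin 3 → K, cp e 0 u + cp e 1 u + cp e 2 u ∈ H 3 := by
    intro u
    have : cp e 0 u + cp e 1 u + cp e 2 u = u 0 • (e 0 + e 3 + e 6) + u 1 • (e 1 + e 4 + e 7) +
        u 2 • (e 2 + e 5 + e 8) := by
      simp [cp, Fin.sum_univ_three, blk]
      module
    rw [this]
    refine Submodule.add_mem _ (Submodule.add_mem _ ?_ ?_) ?_ <;>
      exact Submodule.smul_mem _ _ (Submodule.subset_span (by simp))
  have hcoord : ∀ b : Fin 3, ∀ x ∈ H b.castSucc, ∀ k : Fin 9, k.val / 3 ≠ b.val →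
      e.coord k x = 0 := by
    intro b x hx k hk
    have : H b.castSucc ≤ LinearMap.ker (e.coord k) := by
      fin_cases b <;> refine Submodule.span_le.2 ?_ <;>
        rintro y (rfl | rfl | rfl) <;>
        simp only [SetLike.mem_coe, LinearMap.mem_ker, Module.Basis.coord_apply,
          Module.Basis.repr_self] <;>
        refine Finsupp.single_eq_of_ne ?_ <;> rintro rfl <;> exact hk rfl
    exact this hx
  have hphi : ∀ n : Fin 18, ∀ x ∈ H 3, ∀ j, j ≠ 0 → phi e (Phi n) j x = 0 := by
    intro n x hx j hj
    have : H 3 ≤ LinearMap.ker (phi e (Phi n) j) := by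
      refine Submodule.span_le.2 ?_
      have d : ∀ i : Fin 3, phi e (Phi n) j (e (blk 0 i) + e (blk 1 i) + e (blk 2 i)) = 0 := by
        intro i
        rw [map_add, map_add, phi_e, phi_e, phi_e]
        exact_mod_cast Phi_diag n j hj i
      rintro y (rfl | rfl | rfl)
      · exact d 0
      · exact d 1
      · exact d 2
    exact this hx
  have hW : Q K 6 (H 0) ⊓ Q K 6 (H 1) ⊓ Q K 6 (H 2) ⊓ Q K 6 (H 3) =
      Submodule.span K (Set.range (Bs K e)) := by
    apply le_antisymm
    · rintro w ⟨⟨⟨h0, h1⟩, h2⟩, h3⟩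
      have hX := mem_span_X e (fun b => H b.castSucc) hcoord w
        (by intro b; fin_cases b; exacts [h0, h1, h2])
      obtain ⟨c, rfl⟩ := (Submodule.mem_span_range_iff_exists_fun K).1 hX
      have hc : ∀ n, c (tblP n).1 = c (tblP n).2 := by
        intro n
        have := Fn_Q _ _ 0 (hphi n) _ h3
        rw [Fn_sum] at this
        exact sub_eq_zero.1 this
      refine (Submodule.mem_span_range_iff_exists_fun K).2 ⟨fun n => c (rep n), ?_⟩
      rw [sum_Bs]
      simp only [sym_of_rel c hc]
    · rw [Submodule.span_le]
      rintro _ ⟨n, rfl⟩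
      apply Bs_mem
      intro u v
      have := cube_mem e H hcp hcp4 u v
      exact ⟨⟨⟨this 0, this 1⟩, this 2⟩, this 3⟩
  change Module.finrank K ↥(Q K 6 (H 0) ⊓ Q K 6 (H 1) ⊓ Q K 6 (H 2) ⊓ Q K 6 (H 3)) = 10
  rw [hW, finrank_span_eq_card (Bs_li e)]
  simp
end
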